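/- For every integer k ≥ 1, the polynomials x^k·y·z, x^k·y² and x^k·z² all belong to L. -/

import Mathlib

open MvPolynomial

/-- The defining polynomial `f = x² + y² + z² + Exyz − Ax − By − Cz − D` of the
Markov-type surface. -/
noncomputable def markovPoly (A B C D E : ℂ) : MvPolynomial (Fin 3) ℂ :=
  X 0 ^ 2 + X 1 ^ 2 + X 2 ^ 2 + MvPolynomial.C E * X 0 * X 1 * X 2
    - MvPolynomial.C A * X 0 - MvPolynomial.C B * X 1 - MvPolynomial.C C * X 2
    - MvPolynomial.C D

/-- The Poisson bracket on `ℂ[x,y,z]` induced by the Markov-type surface: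
`{g,h} = f_x·(g_y h_z − g_z h_y) + f_y·(g_z h_x − g_x h_z) + f_z·(g_x h_y − g_y h_x)`,
where `f` is the defining polynomial of the surface. -/
noncomputable def markovBracket (A B C D E : ℂ) (g h : MvPolynomial (Fin 3) ℂ) :
    MvPolynomial (Fin 3) ℂ :=
  pderiv 0 (markovPoly A B C D E) * (pderiv 1 g * pderiv 2 h - pderiv 2 g * pderiv 1 h)
  + pderiv 1 (markovPoly A B C D E) * (pderiv 2 g * pderiv 0 h - pderiv 0 g * pderiv 2 h)
  + pderiv 2 (markovPoly A B C D E) * (pderiv 0 g * pderiv 1 h - pderiv 1 g * pderiv 0 h)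

section MarkovBracket

variable (A B C D E : ℂ) (n : ℕ)

lemma markovBracket_X0_pow_X1 :
    markovBracket A B C D E (X 0 ^ (n + 1)) (X 1) =
      MvPolynomial.C ((n : ℂ) + 1) * (X 0 ^ n *
        (2 * X 2 + MvPolynomial.C E * X 0 * X 1 - MvPolynomial.C C)) := by
  simp [markovBracket, markovPoly, pderiv_X, Derivation.leibniz_pow]
  ring

lemma markovBracket_X2_X0_pow :
    markovBracket A B C D E (X 2) (X 0 ^ (n + 1)) =
      MvPolynomial.C ((n : ℂ) + 1) * (X 0 ^ n *
        (2 * X 1 + MvPolynomial.C E * X 0 * X 2 - MvPolynomial.C B)) := by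
  simp [markovBracket, markovPoly, pderiv_X, Derivation.leibniz_pow]
  ring

lemma markovBracket_X1_X2 :
    markovBracket A B C D E (X 1) (X 2) =
      2 * X 0 + MvPolynomial.C E * (X 1 * X 2) - MvPolynomial.C A := by
  simp [markovBracket, markovPoly, pderiv_X, Derivation.leibniz_pow]
  ring

lemma markovBracket_X0_pow_X1_mul_X2 :
    markovBracket A B C D E (X 0 ^ (n + 1)) (X 1 * X 2) =
      MvPolynomial.C ((n : ℂ) + 1) * (X 0 ^ n * (2 * X 2 ^ 2 - 2 * X 1 ^ 2
        - MvPolynomial.C C * X 2 + MvPolynomial.C B * X 1)) := by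
  simp [markovBracket, markovPoly, pderiv_X, Derivation.leibniz_pow]
  ring

lemma markovBracket_X0_pow_mul_X1_X2 :
    markovBracket A B C D E (X 0 ^ (n + 1) * X 1) (X 2) =
      X 0 ^ (n + 1) * (2 * X 0 + MvPolynomial.C E * X 1 * X 2 - MvPolynomial.C A)
      - MvPolynomial.C ((n : ℂ) + 1) * (X 0 ^ n * X 1 *
        (2 * X 1 + MvPolynomial.C E * X 0 * X 2 - MvPolynomial.C B)) := by
  simp [markovBracket, markovPoly, pderiv_X, Derivation.leibniz_pow]
  ring

end MarkovBracket

lemma Submodule.C_mul_mem {σ R : Type*} [CommSemiring R]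
    (L : Submodule R (MvPolynomial σ R)) (c : R) {p : MvPolynomial σ R} (hp : p ∈ L) :
    MvPolynomial.C c * p ∈ L := by
  rw [← smul_eq_C_mul]
  exact L.smul_mem c hp

lemma Submodule.mem_of_C_mul_mem {σ R : Type*} [Field R]
    (L : Submodule R (MvPolynomial σ R)) {c : R} (hc : c ≠ 0) {p : MvPolynomial σ R}
    (hp : MvPolynomial.C c * p ∈ L) : p ∈ L := by
  rw [← smul_eq_C_mul] at hp
  exact (L.smul_mem_iff hc).1 hp

/-- For every integer `k ≥ 1`, the polynomials `x^k yz`, `x^k y²` and `x^k z²` all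
belong to `L`, where `L` is the smallest ℂ-linear subspace of `ℂ[x,y,z]` containing the
ideal `(f)`, the constant `1` and all powers `x^m, y^m, z^m` (`m ≥ 1`), and closed
under the Poisson bracket. (Formalized by quantifying over all such subspaces `L`.) -/
theorem monomials_deg_kplus2_mem (A B C D E : ℂ) (hE : E ≠ 0) (k : ℕ) (hk : 1 ≤ k)
    (L : Submodule ℂ (MvPolynomial (Fin 3) ℂ))
    (hIdeal : ∀ p ∈ Ideal.span {markovPoly A B C D E}, p ∈ L)
    (hone : (1 : MvPolynomial (Fin 3) ℂ) ∈ L)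
    (hxpow : ∀ m : ℕ, 1 ≤ m → (X 0 : MvPolynomial (Fin 3) ℂ) ^ m ∈ L)
    (hypow : ∀ m : ℕ, 1 ≤ m → (X 1 : MvPolynomial (Fin 3) ℂ) ^ m ∈ L)
    (hzpow : ∀ m : ℕ, 1 ≤ m → (X 2 : MvPolynomial (Fin 3) ℂ) ^ m ∈ L)
    (hbr : ∀ g h : MvPolynomial (Fin 3) ℂ, g ∈ L → h ∈ L → markovBracket A B C D E g h ∈ L) :
    (X 0 : MvPolynomial (Fin 3) ℂ) ^ k * X 1 * X 2 ∈ L ∧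
    (X 0 : MvPolynomial (Fin 3) ℂ) ^ k * X 1 ^ 2 ∈ L ∧
    (X 0 : MvPolynomial (Fin 3) ℂ) ^ k * X 2 ^ 2 ∈ L := by
  have two : (2 : MvPolynomial (Fin 3) ℂ) = MvPolynomial.C 2 := (map_ofNat _ 2).symm
  have hx : ∀ n : ℕ, (X 0 : MvPolynomial (Fin 3) ℂ) ^ n ∈ L := by
    rintro (_ | n)
    · simpa using hone
    · exact hxpow _ n.succ_pos
  have hy : (X 1 : MvPolynomial (Fin 3) ℂ) ∈ L := by simpa using hypow 1 le_rfl
  have hz : (X 2 : MvPolynomial (Fin 3) ℂ) ∈ L := by simpa using hzpow 1 le_rfl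
  have hn : ∀ n : ℕ, (n : ℂ) + 1 ≠ 0 := fun n => by exact_mod_cast n.succ_ne_zero
  have hlin : ∀ n : ℕ, (X 0 : MvPolynomial (Fin 3) ℂ) ^ n * X 1 ∈ L ∧
      (X 0 : MvPolynomial (Fin 3) ℂ) ^ n * X 2 ∈ L := by
    intro n
    induction n with
    | zero => simpa using ⟨hy, hz⟩
    | succ n ih =>
      have h₁ := hbr _ _ (hx (n + 1)) hy
      rw [markovBracket_X0_pow_X1] at h₁
      have h₂ := hbr _ _ hz (hx (n + 1))
      rw [markovBracket_X2_X0_pow] at h₂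
      constructor
      · refine L.mem_of_C_mul_mem hE ?_
        convert L.add_mem (L.sub_mem (L.mem_of_C_mul_mem (hn n) h₁) (L.C_mul_mem 2 ih.2))
          (L.C_mul_mem C (hx n)) using 1
        rw [← two]; ring
      · refine L.mem_of_C_mul_mem hE ?_
        convert L.add_mem (L.sub_mem (L.mem_of_C_mul_mem (hn n) h₂) (L.C_mul_mem 2 ih.1))
          (L.C_mul_mem B (hx n)) using 1
        rw [← two]; ring
  have hyz : (X 1 : MvPolynomial (Fin 3) ℂ) * X 2 ∈ L := by
    have h := hbr _ _ hy hz
    rw [markovBracket_X1_X2] at h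
    refine L.mem_of_C_mul_mem hE ?_
    convert L.add_mem (L.sub_mem h (L.C_mul_mem 2 (hx 1))) (L.C_mul_mem A hone) using 1
    rw [← two]; ring
  have hdiff : ∀ n : ℕ, (X 0 : MvPolynomial (Fin 3) ℂ) ^ n * X 2 ^ 2
      - X 0 ^ n * X 1 ^ 2 ∈ L := by
    intro n
    have h := hbr _ _ (hx (n + 1)) hyz
    rw [markovBracket_X0_pow_X1_mul_X2] at h
    refine L.mem_of_C_mul_mem (two_ne_zero (α := ℂ)) ?_
    convert L.sub_mem (L.add_mem (L.mem_of_C_mul_mem (hn n) h) (L.C_mul_mem C (hlin n).2))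
      (L.C_mul_mem B (hlin n).1) using 1
    rw [← two]; ring
  have hsum : ∀ n : ℕ, (X 0 : MvPolynomial (Fin 3) ℂ) ^ n * X 1 ^ 2 + X 0 ^ n * X 2 ^ 2
      + MvPolynomial.C E * (X 0 ^ (n + 1) * X 1 * X 2) ∈ L := by
    intro n
    have h := hIdeal _ (Ideal.mul_mem_left _ (X 0 ^ n)
      (Ideal.mem_span_singleton_self (markovPoly A B C D E)))
    convert L.add_mem (L.sub_mem h (hx (n + 2))) (L.add_mem (L.add_mem
      (L.C_mul_mem A (hx (n + 1))) (L.C_mul_mem B (hlin n).1))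
      (L.add_mem (L.C_mul_mem C (hlin n).2) (L.C_mul_mem D (hx n)))) using 1
    rw [markovPoly]; ring
  have hxyz : ∀ n : ℕ, (X 0 : MvPolynomial (Fin 3) ℂ) ^ (n + 1) * X 1 * X 2 ∈ L := by
    intro n
    have h := hbr _ _ (hlin (n + 1)).1 hz
    rw [markovBracket_X0_pow_mul_X1_X2] at h
    refine L.mem_of_C_mul_mem hE ?_
    convert L.add_mem
      (L.add_mem (L.sub_mem h (L.C_mul_mem 2 (hx (n + 2)))) (L.C_mul_mem A (hx (n + 1))))
      (L.C_mul_mem ((n : ℂ) + 1) (L.sub_mem (L.sub_mem (hsum n) (hdiff n))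
        (L.C_mul_mem B (hlin n).1))) using 1
    rw [← two]; ring
  have hxyy : (X 0 : MvPolynomial (Fin 3) ℂ) ^ k * X 1 ^ 2 ∈ L := by
    refine L.mem_of_C_mul_mem (two_ne_zero (α := ℂ)) ?_
    convert L.sub_mem (L.sub_mem (hsum k) (hdiff k)) (L.C_mul_mem E (hxyz k)) using 1
    rw [← two]; ring
  refine ⟨?_, hxyy, ?_⟩
  · obtain ⟨n, rfl⟩ := Nat.exists_eq_add_of_le' hk
    exact hxyz n
  · simpa using L.add_mem (hdiff k) hxyy
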